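/- arXiv:math/0308044 — 6 statements merged into one kernel-verified Lean document; each statement's English description precedes it below -/
import Mathlib

section
/- For every μ > 0 there is a constant C > 0, depending only on μ, with the following property: for every T > 0 with √μ·T ∉ 2πℤ and every continuous T-periodic f : ℝ → ℝ, the unique T-periodic C² solution v of v'' + μv = f satisfies sup|v| + sup|v'| + sup|v''| ≤ C·T·(1 − cos(√μ·T))⁻¹ · sup|f|, where all suprema are over ℝ. -/
open Real

/-- Pairing a periodic solution of `v'' + ω² v = f` with the homogeneous solution
`t ↦ cos (ω t + b)` over one period. -/
lemma abs_periodic_boundary_term_le {ω T F : ℝ} (hT : 0 < T) {f v : ℝ → ℝ}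
    (hf : ∀ s, |f s| ≤ F) (hv : ContDiff ℝ 2 v) (hvT : Function.Periodic v T)
    (heq : ∀ s, deriv (deriv v) s + ω ^ 2 * v s = f s) (s b : ℝ) :
    |deriv v s * (cos (ω * (s + T) + b) - cos (ω * s + b)) +
      ω * v s * (sin (ω * (s + T) + b) - sin (ω * s + b))| ≤ F * T := by
  have hv' : ContDiff ℝ 1 (deriv v) :=
    ((contDiff_succ_iff_deriv (n := 1)).1 (by simpa [one_add_one_eq_two] using hv)).2.2
  have hd (t : ℝ) : HasDerivAt v (deriv v t) t :=
    (hv.differentiable (by norm_num) t).hasDerivAt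
  have hd' (t : ℝ) : HasDerivAt (deriv v) (deriv (deriv v) t) t :=
    (hv'.differentiable (by norm_num) t).hasDerivAt
  have hvT' : deriv v (s + T) = deriv v s := by
    rw [← deriv_comp_add_const v T s, funext hvT]
  have hlin (t : ℝ) : HasDerivAt (fun x => ω * x + b) ω t := by
    simpa using ((hasDerivAt_id t).const_mul ω).add_const b
  have hG (t : ℝ) : HasDerivAt
      (fun x => deriv v x * cos (ω * x + b) + ω * v x * sin (ω * x + b))
      (f t * cos (ω * t + b)) t := by
    refine (((hd' t).mul (hlin t).cos).add (((hd t).const_mul ω).mul (hlin t).sin)).congr_deriv ?_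
    rw [← heq t]
    ring
  have hbound (t : ℝ) : ‖f t * cos (ω * t + b)‖ ≤ F := by
    rw [norm_mul, Real.norm_eq_abs, Real.norm_eq_abs]
    exact (mul_le_of_le_one_right (abs_nonneg _) (abs_cos_le_one _)).trans (hf t)
  have h := convex_univ.norm_image_sub_le_of_norm_hasDerivWithin_le
    (fun t _ => (hG t).hasDerivWithinAt) (fun t _ => hbound t)
    (Set.mem_univ s) (Set.mem_univ (s + T))
  rw [add_sub_cancel_left, Real.norm_eq_abs, Real.norm_eq_abs, abs_of_pos hT, hvT', hvT s] at h
  convert h using 2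
  ring


open Real

/-- sup-norm a priori estimate (eq:estimee1) for the periodic solution of
v'' + μ v = f. -/
theorem tube_zero_mode_estimate_one (μ : ℝ) (hμ : 0 < μ) :
    ∃ C > (0:ℝ), ∀ T : ℝ, 0 < T → (¬ ∃ m : ℤ, Real.sqrt μ * T = 2 * π * m) →
      ∀ f : ℝ → ℝ, Continuous f → Function.Periodic f T →
      ∀ v : ℝ → ℝ, ContDiff ℝ 2 v → Function.Periodic v T →
        (∀ s, deriv (deriv v) s + μ * v s = f s) →
        (⨆ s : ℝ, |v s|) + (⨆ s : ℝ, |deriv v s|) + (⨆ s : ℝ, |deriv (deriv v) s|)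
          ≤ C * T * (1 - Real.cos (Real.sqrt μ * T))⁻¹ * ⨆ s : ℝ, |f s| := by
  obtain ⟨ω, hω, rfl⟩ : ∃ ω : ℝ, 0 < ω ∧ μ = ω ^ 2 :=
    ⟨√μ, Real.sqrt_pos.2 hμ, (Real.sq_sqrt hμ.le).symm⟩
  rw [Real.sqrt_sq hω.le]
  refine ⟨1 / ω + 1 + 2 * ω, by positivity, ?_⟩
  intro T hT hm f hfc hfT v hv hvT heq
  have hbdd : BddAbove (Set.range fun s => |f s|) :=
    (hfT.comp abs).compact_of_continuous hT.ne' hfc.abs |>.bddAbove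
  set F := ⨆ s : ℝ, |f s|
  have hf (s : ℝ) : |f s| ≤ F := le_ciSup hbdd s
  have hF : 0 ≤ F := (abs_nonneg _).trans (hf 0)
  have hcos : 1 - cos (ω * T) = 2 * sin (ω * T / 2) ^ 2 := by
    have h := Real.cos_sq (ω * T / 2)
    rw [mul_div_cancel₀ _ two_ne_zero] at h
    linarith [Real.sin_sq_add_cos_sq (ω * T / 2)]
  have hD : 0 < 1 - cos (ω * T) := by
    refine lt_of_le_of_ne (by linarith [cos_le_one (ω * T)]) fun h => hm ?_
    obtain ⟨m, hm⟩ := (Real.cos_eq_one_iff (ω * T)).1 (by linarith)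
    exact ⟨m, by rw [← hm]; ring⟩
  have hDle : 1 - cos (ω * T) ≤ ω * T := by
    have hx : 0 < ω * T := by positivity
    rcases le_total 2 (ω * T) with h | h
    · linarith [neg_one_le_cos (ω * T)]
    · nlinarith [Real.one_sub_sq_div_two_le_cos (x := ω * T)]
  set K := T * (1 - cos (ω * T))⁻¹ with hK
  have hKF : F ≤ ω * (K * F) := by
    have : 1 ≤ ω * K := by
      rw [hK, ← mul_assoc, ← div_eq_mul_inv, le_div_iff₀ hD]
      linarith
    nlinarith
  have hsin : 1 - cos (ω * T) ≤ 2 * |sin (ω * T / 2)| := by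
    rw [hcos, ← sq_abs]
    nlinarith [abs_sin_le_one (ω * T / 2), abs_nonneg (sin (ω * T / 2))]
  have hdiv {y : ℝ} (h : |2 * y * sin (ω * T / 2)| ≤ F * T) : |y| ≤ K * F := by
    rw [abs_mul, abs_mul, abs_two] at h
    rw [hK, mul_right_comm, ← div_eq_mul_inv, le_div_iff₀ hD]
    nlinarith [mul_le_mul_of_nonneg_left hsin (abs_nonneg y)]
  have h₁ (s : ℝ) : ω * (s + T) + (-(ω * s) - ω * T / 2) = ω * T / 2 := by ring
  have h₂ (s : ℝ) : ω * s + (-(ω * s) - ω * T / 2) = -(ω * T / 2) := by ring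
  have hv0 (s : ℝ) : |v s| ≤ 1 / ω * (K * F) := by
    have h := abs_periodic_boundary_term_le hT hf hv hvT heq s (-(ω * s) - ω * T / 2)
    rw [h₁, h₂, cos_neg, sin_neg] at h
    have h' : |ω * v s| ≤ K * F := hdiv (by convert h using 2; ring)
    rw [abs_mul, abs_of_pos hω] at h'
    rw [one_div, ← div_eq_inv_mul, le_div_iff₀ hω]
    linarith
  have hv1 (s : ℝ) : |deriv v s| ≤ K * F := by
    have h := abs_periodic_boundary_term_le hT hf hv hvT heq s
      (-(ω * s) - ω * T / 2 + π / 2)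
    rw [← add_assoc, ← add_assoc, h₁, h₂, cos_add_pi_div_two, cos_add_pi_div_two,
      sin_add_pi_div_two, sin_add_pi_div_two, cos_neg, sin_neg] at h
    exact hdiv (by rw [← abs_neg]; convert h using 2; ring)
  have hv2 (s : ℝ) : |deriv (deriv v) s| ≤ 2 * ω * (K * F) := by
    have h : deriv (deriv v) s = f s - ω ^ 2 * v s := by linarith [heq s]
    have h' : ω ^ 2 * |v s| ≤ ω * (K * F) := by
      calc ω ^ 2 * |v s| ≤ ω ^ 2 * (1 / ω * (K * F)) := by gcongr; exact hv0 s
        _ = ω * (K * F) := by field_simp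
    calc |deriv (deriv v) s| ≤ |f s| + |ω ^ 2 * v s| := h ▸ abs_sub _ _
      _ = |f s| + ω ^ 2 * |v s| := by rw [abs_mul, abs_of_nonneg (sq_nonneg ω)]
      _ ≤ 2 * ω * (K * F) := by linarith [hf s]
  calc _ ≤ 1 / ω * (K * F) + K * F + 2 * ω * (K * F) :=
        add_le_add (add_le_add (ciSup_le hv0) (ciSup_le hv1)) (ciSup_le hv2)
    _ = _ := by rw [hK]; ring
end

section
/- For every μ > 0 there is a constant C > 0, depending only on μ, with the following property: for every T > 0 with √μ·T ∉ 2πℤ and every C¹ T-periodic f : ℝ → ℝ, the unique T-periodic C² solution v of v'' + μv = f satisfies sup|μ·v − f| ≤ C·T·(1 − cos(√μ·T))⁻¹ · sup|f'|, and consequently sup|v| ≤ C·( sup|f| + T·(1 − cos(√μ·T))⁻¹ · sup|f'| ), where all suprema are over ℝ. -/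
open Real

/-- A continuous periodic real function is bounded above in absolute value. -/
lemma Function.Periodic.bddAbove_range_abs {g : ℝ → ℝ} {T : ℝ} (hg : Function.Periodic g T)
    (hT : T ≠ 0) (hc : Continuous g) : BddAbove (Set.range fun s => |g s|) := by
  have hp : Function.Periodic (fun s => |g s|) T := fun s => by simp only [hg s]
  exact (hp.isBounded_of_continuous hT hc.abs).bddAbove

/-- The derivative of a periodic function is periodic. -/
lemma Function.Periodic.periodic_deriv {g : ℝ → ℝ} {T : ℝ} (hg : Function.Periodic g T) :
    Function.Periodic (deriv g) T := fun s => by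
  rw [← deriv_comp_add_const, show (fun x => g (x + T)) = g from funext hg]

/-- Pointwise bound for the second derivative of a periodic solution of `v'' + ω² v = f`, in
terms of a bound for `f'`. -/
lemma one_sub_cos_mul_abs_le {ω T M : ℝ} (hT : 0 < T) {f v : ℝ → ℝ}
    (hf : ContDiff ℝ 1 f) (hfT : Function.Periodic f T)
    (hv : ContDiff ℝ 2 v) (hvT : Function.Periodic v T)
    (hode : ∀ s, deriv (deriv v) s + ω ^ 2 * v s = f s)
    (hM : ∀ s, |deriv f s| ≤ M) (s : ℝ) :
    (1 - cos (ω * T)) * |ω ^ 2 * v s - f s| ≤ M * T := by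
  set z : ℝ → ℂ := fun t => ((f t - ω ^ 2 * v t : ℝ) : ℂ) + Complex.I * ω * (deriv v t : ℝ) with hz
  set E : ℝ → ℂ := fun t => Complex.exp ((-(ω * (t - s)) : ℝ) * Complex.I) with hE
  have hdf : ∀ t, HasDerivAt f (deriv f t) t := fun t =>
    (hf.differentiable (by norm_num) t).hasDerivAt
  have hdv : ∀ t, HasDerivAt v (deriv v t) t := fun t =>
    (hv.differentiable (by norm_num) t).hasDerivAt
  have hddv : ∀ t, HasDerivAt (deriv v) (f t - ω ^ 2 * v t) t := fun t => by
    have h1 : ContDiff ℝ 1 (deriv v) := by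
      have h2 : ContDiff ℝ (1 + 1) v := by simpa [one_add_one_eq_two] using hv
      exact (contDiff_succ_iff_deriv.1 h2).2.2
    rw [← eq_sub_of_add_eq (hode t)]
    exact (h1.differentiable (by norm_num) t).hasDerivAt
  have hdE : ∀ t, HasDerivAt E (E t * (-ω * Complex.I)) t := fun t => by
    have h1 : HasDerivAt (fun t : ℝ => -(ω * (t - s))) (-(ω * 1)) t :=
      (((hasDerivAt_id t).sub_const s).const_mul ω).neg
    have h2 := (h1.ofReal_comp.mul_const Complex.I).cexp
    simpa [hE] using h2
  have hdz : ∀ t, HasDerivAt z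
      (((deriv f t - ω ^ 2 * deriv v t : ℝ) : ℂ)
        + Complex.I * ω * ((f t - ω ^ 2 * v t : ℝ) : ℂ)) t := fun t =>
    ((hdf t).sub ((hdv t).const_mul (ω ^ 2))).ofReal_comp.add
      ((hddv t).ofReal_comp.const_mul (Complex.I * ω))
  have hdEz : ∀ t, HasDerivAt (fun t => E t * z t) (E t * (deriv f t : ℝ)) t := fun t => by
    refine ((hdE t).mul (hdz t)).congr_deriv ?_
    simp only [hz]
    push_cast
    linear_combination (-(E t * ω ^ 2 * (deriv v t : ℝ))) * Complex.I_sq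
  have hEz : ‖E (s + T) * z (s + T) - E s * z s‖ ≤ M * T := by
    have := Convex.norm_image_sub_le_of_norm_hasDerivWithin_le (C := M) (s := Set.univ)
      (fun t _ => (hdEz t).hasDerivWithinAt)
      (fun t _ => by
        rw [norm_mul, hE, Complex.norm_exp_ofReal_mul_I, one_mul, Complex.norm_real]
        exact hM t) convex_univ (Set.mem_univ s) (Set.mem_univ (s + T))
    simpa [abs_of_pos hT] using this
  have hzT : z (s + T) = z s := by simp only [hz, hfT s, hvT s, hvT.periodic_deriv s]
  have hEs : E s = 1 := by simp [hE]
  have hEre : (E (s + T)).re = cos (ω * T) := by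
    simp only [hE, Complex.exp_ofReal_mul_I_re, add_sub_cancel_left, cos_neg]
  rw [hzT, hEs, ← sub_mul, norm_mul] at hEz
  refine le_trans (mul_le_mul ?_ ?_ (abs_nonneg _) (norm_nonneg _)) hEz
  · have h1 := (neg_le_abs _).trans (Complex.abs_re_le_norm (E (s + T) - 1))
    rw [Complex.sub_re, hEre, Complex.one_re] at h1
    linarith
  · have h1 := Complex.abs_re_le_norm (z s)
    have h2 : (z s).re = f s - ω ^ 2 * v s := by
      simp only [hz, Complex.add_re, Complex.ofReal_re, Complex.mul_re, Complex.I_re,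
        Complex.I_im, Complex.mul_im, Complex.ofReal_im]
      ring
    rwa [h2, abs_sub_comm] at h1

/-- sup-norm a priori estimate (eq:estimee2) for the periodic solution of
v'' + μ v = f when f is C¹. -/
theorem tube_zero_mode_estimate_two (μ : ℝ) (hμ : 0 < μ) :
    ∃ C > (0:ℝ), ∀ T : ℝ, 0 < T → (¬ ∃ m : ℤ, Real.sqrt μ * T = 2 * π * m) →
      ∀ f : ℝ → ℝ, ContDiff ℝ 1 f → Function.Periodic f T →
      ∀ v : ℝ → ℝ, ContDiff ℝ 2 v → Function.Periodic v T →
        (∀ s, deriv (deriv v) s + μ * v s = f s) →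
        (⨆ s : ℝ, |μ * v s - f s|)
            ≤ C * T * (1 - Real.cos (Real.sqrt μ * T))⁻¹ * ⨆ s : ℝ, |deriv f s| ∧
        (⨆ s : ℝ, |v s|)
            ≤ C * ((⨆ s : ℝ, |f s|) +
              T * (1 - Real.cos (Real.sqrt μ * T))⁻¹ * ⨆ s : ℝ, |deriv f s|) := by
  have hC : 0 < μ⁻¹ := inv_pos.2 hμ
  refine ⟨1 + μ⁻¹, by positivity, fun T hT hres f hf hfT v hv hvT hode => ?_⟩
  have hcos : 0 < 1 - cos (√μ * T) := by
    refine sub_pos.2 (lt_of_le_of_ne (cos_le_one _) fun h => hres ?_)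
    obtain ⟨m, hm⟩ := (cos_eq_one_iff _).1 h
    exact ⟨m, by rw [← hm]; ring⟩
  have hM := hfT.periodic_deriv.bddAbove_range_abs hT.ne' (hf.continuous_deriv le_rfl)
  have hF := hfT.bddAbove_range_abs hT.ne' hf.continuous
  set M := ⨆ s : ℝ, |deriv f s|
  set F := ⨆ s : ℝ, |f s|
  set K := T * (1 - cos (√μ * T))⁻¹ * M with hK
  have hM0 : 0 ≤ M := Real.iSup_nonneg fun s => abs_nonneg _
  have hF0 : 0 ≤ F := Real.iSup_nonneg fun s => abs_nonneg _
  have hK0 : 0 ≤ K := by positivity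
  have key : ∀ s, |μ * v s - f s| ≤ K := fun s => by
    have h := one_sub_cos_mul_abs_le (ω := √μ) hT hf hfT hv hvT
      (by simpa only [sq_sqrt hμ.le] using hode) (fun s => le_ciSup hM s) s
    rw [sq_sqrt hμ.le, mul_comm, ← le_div_iff₀ hcos] at h
    exact h.trans_eq (by rw [hK]; ring)
  constructor
  · refine ciSup_le fun s => (key s).trans ?_
    calc K ≤ K + μ⁻¹ * K := le_add_of_nonneg_right (by positivity)
      _ = _ := by rw [hK]; ring
  · refine ciSup_le fun s => ?_
    have h1 : |μ * v s| ≤ F + K := by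
      have h2 := abs_add_le (f s) (μ * v s - f s)
      rw [add_sub_cancel] at h2
      exact h2.trans (add_le_add (le_ciSup hF s) (key s))
    rw [abs_mul, abs_of_pos hμ] at h1
    calc |v s| = μ⁻¹ * (μ * |v s|) := by field_simp
      _ ≤ μ⁻¹ * (F + K) := by gcongr
      _ ≤ (1 + μ⁻¹) * (F + K) := by gcongr; linarith
end

section
/- Let μ > 0, T > 0 and let k be a nonnegative integer with 2πk < √μ·T < 2π(k+1). Then the maximal dimension of a finite-dimensional real subspace V of the space of T-periodic C¹ functions ℝ → ℝ such that ∫₀ᵀ ( v'(s)² − μ·v(s)² ) ds < 0 for every nonzero v ∈ V is exactly 2k + 1. -/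
open Real

/-- The `n`-th Fourier coefficient on `[0, T]` of a real function. -/
noncomputable def realFourierCoeff (T : ℝ) (v : ℝ → ℝ) (n : ℤ) : ℂ :=
  (T : ℂ)⁻¹ * ∫ s in (0:ℝ)..T, Complex.exp (-(2 * π * Complex.I * n * s / T)) * (v s : ℂ)

/-- The function `s ↦ cos (2πms/T) + sin (2πms/T)`; for `m : ℤ` these form a real trigonometric
basis of the `T`-periodic functions. -/
noncomputable def casFun (T : ℝ) (m : ℤ) (s : ℝ) : ℝ :=
  cos (2 * π * m * s / T) + sin (2 * π * m * s / T)

theorem fourierCoeffOn_ofReal {T : ℝ} (hT : 0 < T) (v : ℝ → ℝ) (n : ℤ) :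
    fourierCoeffOn hT (fun s => (v s : ℂ)) n = realFourierCoeff T v n := by
  rw [fourierCoeffOn_eq_integral, realFourierCoeff]
  simp only [fourier_coe_apply, smul_eq_mul, sub_zero, Complex.real_smul]
  push_cast
  rw [one_div]
  congr 2
  ext s
  congr 2
  ring

theorem intervalIntegrable_exp_mul_ofReal {v : ℝ → ℝ} (hv : Continuous v) (T : ℝ) (n : ℤ) :
    IntervalIntegrable
      (fun s : ℝ => Complex.exp (-(2 * π * Complex.I * n * s / T)) * (v s : ℂ))
      MeasureTheory.volume 0 T := by
  apply Continuous.intervalIntegrable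
  fun_prop

theorem realFourierCoeff_add {T : ℝ} {u v : ℝ → ℝ} (hu : Continuous u) (hv : Continuous v)
    (n : ℤ) : realFourierCoeff T (u + v) n = realFourierCoeff T u n + realFourierCoeff T v n := by
  simp only [realFourierCoeff, ← mul_add]
  rw [← intervalIntegral.integral_add (intervalIntegrable_exp_mul_ofReal hu T n)
    (intervalIntegrable_exp_mul_ofReal hv T n)]
  congr 2
  ext s
  simp only [Pi.add_apply, Complex.ofReal_add]
  ring

theorem realFourierCoeff_smul (T c : ℝ) (v : ℝ → ℝ) (n : ℤ) :
    realFourierCoeff T (c • v) n = c * realFourierCoeff T v n := by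
  simp only [realFourierCoeff]
  rw [mul_left_comm, ← intervalIntegral.integral_const_mul (c : ℂ)]
  congr 2
  ext s
  simp only [Pi.smul_apply, smul_eq_mul, Complex.ofReal_mul]
  ring

theorem realFourierCoeff_sum {ι : Type*} (S : Finset ι) {T : ℝ} {f : ι → ℝ → ℝ}
    (hf : ∀ i, Continuous (f i)) (n : ℤ) :
    realFourierCoeff T (∑ i ∈ S, f i) n = ∑ i ∈ S, realFourierCoeff T (f i) n := by
  classical
  induction S using Finset.induction_on with
  | empty => simp [realFourierCoeff]
  | insert i S hi ih =>
    have hc : Continuous (∑ i ∈ S, f i) := by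
      rw [show (∑ i ∈ S, f i) = fun s => ∑ i ∈ S, f i s by ext s; simp]
      fun_prop
    rw [Finset.sum_insert hi, Finset.sum_insert hi, realFourierCoeff_add (hf i) hc, ih]

theorem realFourierCoeff_neg (T : ℝ) (v : ℝ → ℝ) (n : ℤ) :
    realFourierCoeff T v (-n) = (starRingEnd ℂ) (realFourierCoeff T v n) := by
  simp only [realFourierCoeff, map_mul, map_inv₀, Complex.conj_ofReal]
  rw [intervalIntegral.intervalIntegral_eq_integral_uIoc,
    intervalIntegral.intervalIntegral_eq_integral_uIoc]
  rw [Complex.real_smul, Complex.real_smul, map_mul, Complex.conj_ofReal, ← integral_conj]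
  congr 3
  ext s
  simp [← Complex.exp_conj, Complex.conj_ofNat]

theorem eq_zero_of_re_add_im_of_conj {z : ℂ} (h : z.re + z.im = 0)
    (h' : ((starRingEnd ℂ) z).re + ((starRingEnd ℂ) z).im = 0) : z = 0 := by
  simp only [Complex.conj_re, Complex.conj_im] at h'
  apply Complex.ext <;> simp <;> linarith

theorem memLp_two_ofReal {f : ℝ → ℝ} (hf : Continuous f) (T : ℝ) :
    MeasureTheory.MemLp (fun s => (f s : ℂ)) 2
      (MeasureTheory.volume.restrict (Set.Ioc 0 T)) := by
  have hc : Continuous fun s => (f s : ℂ) := by fun_prop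
  rw [MeasureTheory.memLp_two_iff_integrable_sq_norm hc.aestronglyMeasurable]
  exact (hc.norm.pow 2).integrableOn_Ioc

theorem hasSum_sq_realFourierCoeff {T : ℝ} (hT : 0 < T) {f : ℝ → ℝ} (hf : Continuous f) :
    HasSum (fun n => ‖realFourierCoeff T f n‖ ^ 2) (T⁻¹ * ∫ s in (0:ℝ)..T, f s ^ 2) := by
  simpa [fourierCoeffOn_ofReal] using hasSum_sq_fourierCoeffOn hT (memLp_two_ofReal hf T)

theorem realFourierCoeff_deriv {T : ℝ} (hT : 0 < T) {v : ℝ → ℝ} (hv : ContDiff ℝ 1 v)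
    (hp : Function.Periodic v T) (n : ℤ) :
    realFourierCoeff T (deriv v) n = (2 * π * Complex.I * n / T) * realFourierCoeff T v n := by
  have hd : ∀ x, HasDerivAt v (deriv v x) x := fun x =>
    (hv.differentiable one_ne_zero x).hasDerivAt
  have hc : Continuous (deriv v) := hv.continuous_deriv le_rfl
  have h0 : v T = v 0 := by simpa using hp 0
  have hTc : (T : ℂ) ≠ 0 := by exact_mod_cast hT.ne'
  rcases eq_or_ne n 0 with rfl | hn
  · have : ∫ s in (0:ℝ)..T, deriv v s = 0 := by
      rw [intervalIntegral.integral_eq_sub_of_hasDerivAt (fun x _ => hd x)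
        (hc.intervalIntegrable _ _), h0, sub_self]
    simp [realFourierCoeff, intervalIntegral.integral_ofReal, this]
  · have h := fourierCoeffOn_of_hasDerivAt (f := fun s => (v s : ℂ))
      (f' := fun s => ((deriv v s : ℝ) : ℂ)) hT hn (fun x _ => (hd x).ofReal_comp)
      ((Complex.continuous_ofReal.comp hc).intervalIntegrable _ _)
    rw [fourierCoeffOn_ofReal, fourierCoeffOn_ofReal, h0] at h
    have hnc : (n : ℂ) ≠ 0 := by exact_mod_cast hn
    have hpi : (π : ℂ) ≠ 0 := by exact_mod_cast pi_ne_zero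
    rw [h]
    simp only [sub_self, mul_zero, Complex.ofReal_zero, sub_zero, zero_sub]
    field_simp [Complex.I_ne_zero]

theorem hasSum_quadraticForm {T : ℝ} (hT : 0 < T) (μ : ℝ) {v : ℝ → ℝ} (hv : ContDiff ℝ 1 v)
    (hp : Function.Periodic v T) :
    HasSum (fun n : ℤ => ((2 * π * n / T) ^ 2 - μ) * ‖realFourierCoeff T v n‖ ^ 2)
      (T⁻¹ * ∫ s in (0:ℝ)..T, ((deriv v s) ^ 2 - μ * (v s) ^ 2)) := by
  have hc : Continuous (deriv v) := hv.continuous_deriv le_rfl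
  have hvc := hv.continuous
  have h := (hasSum_sq_realFourierCoeff hT hc).sub
    ((hasSum_sq_realFourierCoeff hT hvc).mul_left μ)
  rw [intervalIntegral.integral_sub
    (Continuous.intervalIntegrable (by fun_prop) _ _)
    (Continuous.intervalIntegrable (by fun_prop) _ _), intervalIntegral.integral_const_mul]
  refine (congrArg₂ (fun f a => HasSum f a) (funext fun n => ?_) ?_).mpr h
  · rw [realFourierCoeff_deriv hT hv hp, norm_mul, mul_pow, sub_mul]
    congr 2
    rw [show (2 * π * Complex.I * n / T : ℂ) = ((2 * π * n / T : ℝ) : ℂ) * Complex.I by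
      push_cast; ring]
    rw [norm_mul, Complex.norm_I, mul_one, Complex.norm_real, norm_eq_abs, sq_abs]
  · ring

theorem contDiff_casFun (T : ℝ) (m : ℤ) : ContDiff ℝ 1 (casFun T m) := by
  unfold casFun
  fun_prop

theorem periodic_casFun {T : ℝ} (hT : 0 < T) (m : ℤ) : Function.Periodic (casFun T m) T := by
  intro s
  have : 2 * π * m * (s + T) / T = 2 * π * m * s / T + m * (2 * π) := by
    field_simp
  simp only [casFun, this, cos_add_int_mul_two_pi, sin_add_int_mul_two_pi]

theorem integral_exp_int {T : ℝ} (hT : 0 < T) (m : ℤ) :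
    ∫ s in (0:ℝ)..T, Complex.exp (2 * π * Complex.I * m / T * s) =
      if m = 0 then (T : ℂ) else 0 := by
  have hTc : (T : ℂ) ≠ 0 := by exact_mod_cast hT.ne'
  split_ifs with hm
  · simp [hm]
  · have hnc : (m : ℂ) ≠ 0 := by exact_mod_cast hm
    have hpi : (π : ℂ) ≠ 0 := by exact_mod_cast pi_ne_zero
    have hne : (2 * π * Complex.I * m / T : ℂ) ≠ 0 := by
      simp [hTc, hnc, hpi, Complex.I_ne_zero]
    rw [integral_exp_mul_complex hne]
    have : (2 * π * Complex.I * m / T * T : ℂ) = m * (2 * π * Complex.I) := by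
      field_simp
    rw [this, Complex.exp_int_mul_two_pi_mul_I]
    simp

theorem realFourierCoeff_casFun {T : ℝ} (hT : 0 < T) (m n : ℤ) :
    realFourierCoeff T (casFun T m) n =
      (if m = n then (1 - Complex.I) / 2 else 0) + if m = -n then (1 + Complex.I) / 2 else 0 := by
  have hTc : (T : ℂ) ≠ 0 := by exact_mod_cast hT.ne'
  have key : ∀ s : ℝ, Complex.exp (-(2 * π * Complex.I * n * s / T)) * (casFun T m s : ℂ) =
      (1 - Complex.I) / 2 * Complex.exp (2 * π * Complex.I * (m - n : ℤ) / T * s) +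
      (1 + Complex.I) / 2 * Complex.exp (2 * π * Complex.I * (-m - n : ℤ) / T * s) := by
    intro s
    have e1 : (2 * π * Complex.I * (m - n : ℤ) / T * s : ℂ) =
        -(2 * π * Complex.I * n * s / T) + (2 * π * m * s / T) * Complex.I := by
      push_cast; ring
    have e2 : (2 * π * Complex.I * (-m - n : ℤ) / T * s : ℂ) =
        -(2 * π * Complex.I * n * s / T) + (-(2 * π * m * s / T)) * Complex.I := by
      push_cast; ring
    rw [e1, e2, Complex.exp_add, Complex.exp_add, Complex.exp_mul_I, Complex.exp_mul_I,
      Complex.cos_neg, Complex.sin_neg, casFun]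
    push_cast
    linear_combination (Complex.exp (-(2 * π * Complex.I * n * s / T)) *
      Complex.sin (2 * π * m * s / T)) * Complex.I_sq
  rw [realFourierCoeff]
  simp only [key]
  rw [intervalIntegral.integral_add (Continuous.intervalIntegrable (by fun_prop) _ _)
    (Continuous.intervalIntegrable (by fun_prop) _ _), intervalIntegral.integral_const_mul,
    intervalIntegral.integral_const_mul, integral_exp_int hT, integral_exp_int hT, mul_add]
  have h1 : m - n = 0 ↔ m = n := sub_eq_zero
  have h2 : -m - n = 0 ↔ m = -n := by omega
  simp only [h1, h2]
  congr 1 <;> split_ifs <;> field_simp <;> simp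

theorem sq_lt_of_natAbs_le {μ T : ℝ} (hT : 0 < T) {k : ℕ} (hk : 2 * π * k < √μ * T) {n : ℤ}
    (hn : n.natAbs ≤ k) : (2 * π * n / T) ^ 2 < μ := by
  rw [← sq_abs]
  refine (Real.lt_sqrt (abs_nonneg _)).1 ?_
  have hn' : |(n : ℝ)| ≤ k := by
    rw [← Int.cast_abs, ← Int.natCast_natAbs]
    exact_mod_cast hn
  rw [abs_div, abs_mul, abs_of_pos hT, abs_of_pos two_pi_pos, div_lt_iff₀ hT]
  exact (mul_le_mul_of_nonneg_left hn' two_pi_pos.le).trans_lt hk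

theorem le_sq_of_lt_natAbs {μ T : ℝ} (hT : 0 < T) {k : ℕ}
    (hk : √μ * T < 2 * π * (k + 1)) {n : ℤ} (hn : k < n.natAbs) :
    μ ≤ (2 * π * n / T) ^ 2 := by
  rw [← sq_abs, ← Real.sqrt_le_left (abs_nonneg _)]
  have hn' : (k : ℝ) + 1 ≤ |(n : ℝ)| := by
    rw [← Int.cast_abs, ← Int.natCast_natAbs]
    exact_mod_cast hn
  rw [abs_div, abs_mul, abs_of_pos hT, abs_of_pos two_pi_pos, le_div_iff₀ hT]
  exact hk.le.trans (mul_le_mul_of_nonneg_left hn' two_pi_pos.le)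

/-- The linear combinations of the `casFun T m` with `|m| ≤ k`. -/
noncomputable def casComb (T : ℝ) (k : ℕ) :
    (Finset.Icc (-k : ℤ) k → ℝ) →ₗ[ℝ] (ℝ → ℝ) :=
  Fintype.linearCombination ℝ fun m => casFun T m

theorem realFourierCoeff_casComb {T : ℝ} (hT : 0 < T) (k : ℕ) (a : Finset.Icc (-k : ℤ) k → ℝ)
    (n : ℤ) : realFourierCoeff T (casComb T k a) n =
      ∑ m : Finset.Icc (-k : ℤ) k, (a m : ℂ) * ((if (m : ℤ) = n then (1 - Complex.I) / 2 else 0) +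
        if (m : ℤ) = -n then (1 + Complex.I) / 2 else 0) := by
  rw [casComb, Fintype.linearCombination_apply, realFourierCoeff_sum]
  · simp only [realFourierCoeff_smul, realFourierCoeff_casFun hT]
  · intro m
    exact (contDiff_casFun T m).continuous.const_smul (a m)

theorem realFourierCoeff_casComb_of_lt {T : ℝ} (hT : 0 < T) {k : ℕ}
    (a : Finset.Icc (-k : ℤ) k → ℝ) {n : ℤ} (hn : k < n.natAbs) :
    realFourierCoeff T (casComb T k a) n = 0 := by
  rw [realFourierCoeff_casComb hT]
  refine Finset.sum_eq_zero fun m _ => ?_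
  have hm := Finset.mem_Icc.1 m.2
  rw [if_neg (by omega), if_neg (by omega)]
  simp

theorem realFourierCoeff_casComb_ne_zero {T : ℝ} (hT : 0 < T) {k : ℕ}
    {a : Finset.Icc (-k : ℤ) k → ℝ} {n : Finset.Icc (-k : ℤ) k} (hn : a n ≠ 0) :
    realFourierCoeff T (casComb T k a) n ≠ 0 := by
  have hm := Finset.mem_Icc.1 n.2
  let n' : Finset.Icc (-k : ℤ) k := ⟨-n, Finset.mem_Icc.2 (by omega)⟩
  have h1 : ∀ m : Finset.Icc (-k : ℤ) k, (m : ℤ) = n ↔ m = n := fun m => Subtype.ext_iff.symm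
  have h2 : ∀ m : Finset.Icc (-k : ℤ) k, (m : ℤ) = -n ↔ m = n' := fun m => by
    simp [n', Subtype.ext_iff]
  rw [realFourierCoeff_casComb hT]
  simp only [h1, h2, mul_add, Finset.sum_add_distrib, mul_ite, mul_zero, Finset.sum_ite_eq',
    Finset.mem_univ, if_true]
  intro h
  have hre := congrArg Complex.re h
  have him := congrArg Complex.im h
  simp at hre him
  apply hn
  linarith

theorem contDiff_periodic_casComb {T : ℝ} (hT : 0 < T) (k : ℕ)
    (a : Finset.Icc (-k : ℤ) k → ℝ) :
    ContDiff ℝ 1 (casComb T k a) ∧ Function.Periodic (casComb T k a) T := by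
  have h : (casComb T k a) = fun s => ∑ m, a m * casFun T m s := by
    ext s
    simp [casComb, Fintype.linearCombination_apply]
  rw [h]
  refine ⟨ContDiff.sum fun m _ => contDiff_const.mul (contDiff_casFun T m), fun s => ?_⟩
  simp only [periodic_casFun hT _ s]

theorem injective_casComb {T : ℝ} (hT : 0 < T) (k : ℕ) : Function.Injective (casComb T k) := by
  rw [← LinearMap.ker_eq_bot, LinearMap.ker_eq_bot']
  intro a ha
  by_contra hne
  obtain ⟨n, hn⟩ := Function.ne_iff.1 hne
  apply realFourierCoeff_casComb_ne_zero hT hn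
  simp [ha, realFourierCoeff]

theorem quadraticForm_casComb_neg {μ T : ℝ} (hT : 0 < T) {k : ℕ} (hk : 2 * π * k < √μ * T)
    {a : Finset.Icc (-k : ℤ) k → ℝ} (ha : a ≠ 0) :
    ∫ s in (0:ℝ)..T, ((deriv (casComb T k a) s) ^ 2 - μ * (casComb T k a s) ^ 2) < 0 := by
  obtain ⟨n, hn⟩ := Function.ne_iff.1 ha
  obtain ⟨hd, hp⟩ := contDiff_periodic_casComb hT k a
  have hm := Finset.mem_Icc.1 n.2
  have h := hasSum_lt (i := (n : ℤ)) (fun j => ?_) ?_ (hasSum_quadraticForm hT μ hd hp)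
    (hasSum_zero (α := ℝ))
  · exact neg_of_mul_neg_right h (inv_pos.2 hT).le
  · rcases le_or_gt j.natAbs k with hj | hj
    · exact mul_nonpos_of_nonpos_of_nonneg
        (sub_nonpos.2 (sq_lt_of_natAbs_le hT hk hj).le) (sq_nonneg _)
    · simp [realFourierCoeff_casComb_of_lt hT a hj]
  · exact mul_neg_of_neg_of_pos
      (sub_neg.2 (sq_lt_of_natAbs_le hT hk (by omega)))
      (pow_pos (norm_pos_iff.2 (realFourierCoeff_casComb_ne_zero hT hn)) 2)

theorem quadraticForm_nonneg {μ T : ℝ} (hT : 0 < T) {k : ℕ}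
    (hk : √μ * T < 2 * π * (k + 1)) {v : ℝ → ℝ} (hv : ContDiff ℝ 1 v)
    (hp : Function.Periodic v T) (h0 : ∀ n : ℤ, n.natAbs ≤ k → realFourierCoeff T v n = 0) :
    0 ≤ ∫ s in (0:ℝ)..T, ((deriv v s) ^ 2 - μ * (v s) ^ 2) := by
  refine (mul_nonneg_iff_of_pos_left (inv_pos.2 hT)).1
    ((hasSum_quadraticForm hT μ hv hp).nonneg fun n => ?_)
  rcases le_or_gt n.natAbs k with hn | hn
  · simp [h0 n hn]
  · exact mul_nonneg (sub_nonneg.2 (le_sq_of_lt_natAbs hT hk hn)) (sq_nonneg _)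

/-- The low-frequency Fourier data of the elements of a space of continuous functions. -/
noncomputable def lowFrequencyMap (T : ℝ) (k : ℕ) (V : Submodule ℝ (ℝ → ℝ))
    (hV : ∀ v ∈ V, Continuous v) : V →ₗ[ℝ] (Finset.Icc (-k : ℤ) k → ℝ) where
  toFun v n := (realFourierCoeff T v n).re + (realFourierCoeff T v n).im
  map_add' u v := by
    ext n
    simp only [Submodule.coe_add, realFourierCoeff_add (hV u u.2) (hV v v.2), Complex.add_re,
      Complex.add_im, Pi.add_apply]
    ring
  map_smul' c v := by
    ext n
    simp only [Submodule.coe_smul, realFourierCoeff_smul, Complex.re_ofReal_mul,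
      Complex.im_ofReal_mul, Pi.smul_apply, smul_eq_mul, RingHom.id_apply]
    ring

theorem realFourierCoeff_eq_zero_of_lowFrequencyMap {T : ℝ} {k : ℕ} {V : Submodule ℝ (ℝ → ℝ)}
    {hV : ∀ v ∈ V, Continuous v} {v : V} (h : lowFrequencyMap T k V hV v = 0) {n : ℤ}
    (hn : n.natAbs ≤ k) : realFourierCoeff T v n = 0 := by
  have h1 := congrFun h ⟨n, Finset.mem_Icc.2 (by omega)⟩
  have h2 := congrFun h ⟨-n, Finset.mem_Icc.2 (by omega)⟩
  simp only [lowFrequencyMap, LinearMap.coe_mk, AddHom.coe_mk, Pi.zero_apply] at h1 h2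
  rw [realFourierCoeff_neg] at h2
  exact eq_zero_of_re_add_im_of_conj h1 h2

theorem finrank_Icc_neg_fun (k : ℕ) :
    Module.finrank ℝ (Finset.Icc (-k : ℤ) k → ℝ) = 2 * k + 1 := by
  rw [Module.finrank_fintype_fun_eq_card, Fintype.card_coe, Int.card_Icc]
  omega

/-- for 2πk < √μ T < 2π(k+1), the index of the quadratic form
∫ (v'² − μ v²) on T-periodic C¹ functions is exactly 2k + 1. -/
theorem tube_zero_mode_index (μ T : ℝ) (hμ : 0 < μ) (hT : 0 < T) (k : ℕ)
    (hk₁ : 2 * π * k < Real.sqrt μ * T) (hk₂ : Real.sqrt μ * T < 2 * π * (k + 1)) :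
    IsGreatest {d : ℕ | ∃ V : Submodule ℝ (ℝ → ℝ),
        FiniteDimensional ℝ V ∧ Module.finrank ℝ V = d ∧
        (∀ v ∈ V, ContDiff ℝ 1 v ∧ Function.Periodic v T) ∧
        (∀ v ∈ V, v ≠ 0 →
          (∫ s in (0:ℝ)..T, ((deriv v s) ^ 2 - μ * (v s) ^ 2)) < 0)}
      (2 * k + 1) := by
  constructor
  · refine ⟨LinearMap.range (casComb T k), inferInstance, ?_, ?_, ?_⟩
    · rw [LinearMap.finrank_range_of_inj (injective_casComb hT k), finrank_Icc_neg_fun]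
    · rintro _ ⟨a, rfl⟩
      exact contDiff_periodic_casComb hT k a
    · rintro _ ⟨a, rfl⟩ hne
      refine quadraticForm_casComb_neg hT hk₁ ?_
      rintro rfl
      exact hne (map_zero _)
  · rintro d ⟨V, hfin, rfl, hV, hneg⟩
    by_contra! hlt
    have hker := (lowFrequencyMap T k V fun v hv =>
      (hV v hv).1.continuous).ker_ne_bot_of_finrank_lt (by rwa [finrank_Icc_neg_fun])
    obtain ⟨v, hv, hne⟩ := Submodule.exists_mem_ne_zero_of_ne_bot hker
    obtain ⟨hd, hp⟩ := hV v v.2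
    refine (hneg v v.2 fun h => hne (Subtype.ext h)).not_ge ?_
    exact quadraticForm_nonneg hT hk₂ hd hp fun n hn =>
      realFourierCoeff_eq_zero_of_lowFrequencyMap (LinearMap.mem_ker.1 hv) hn
end

section
/- There is a universal constant c > 0 with the following property. Let μ > 0, T > 0 and let k be a nonnegative integer with 2π(k + 1/3) ≤ √μ·T ≤ 2π(k + 2/3). Then every function v in the linear span of the functions s ↦ cos(2πms/T) and s ↦ sin(2πms/T) for integers 0 ≤ m ≤ k satisfies ∫₀ᵀ ( μ·v(s)² − v'(s)² ) ds ≥ c·(1 + √μ·T)⁻¹ · ∫₀ᵀ ( v'(s)² + μ·v(s)² ) ds. -/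
open Real

/-- A trigonometric polynomial in amplitude-phase form. -/
noncomputable def trigPoly (ω : ℝ) (k : ℕ) (r φ : ℕ → ℝ) (s : ℝ) : ℝ :=
  ∑ m ∈ Finset.range (k + 1), r m * cos (ω * m * s - φ m)

lemma hasDerivAt_trigPoly (ω : ℝ) (k : ℕ) (r φ : ℕ → ℝ) (s : ℝ) :
    HasDerivAt (trigPoly ω k r φ)
      (∑ m ∈ Finset.range (k + 1), r m * (-sin (ω * m * s - φ m) * (ω * m))) s := by
  unfold trigPoly
  refine HasDerivAt.fun_sum fun m _ => ?_
  have h : HasDerivAt (fun s : ℝ => ω * m * s - φ m) (ω * m) s := by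
    simpa using ((hasDerivAt_id s).const_mul (ω * m)).sub_const (φ m)
  exact h.cos.const_mul (r m)

lemma integral_cos_mul_sub_eq_zero {T : ℝ} (hT : T ≠ 0) {j : ℤ} (hj : j ≠ 0) (θ : ℝ) :
    ∫ s in (0:ℝ)..T, cos (2 * π / T * j * s - θ) = 0 := by
  have hj' : (j : ℝ) ≠ 0 := by exact_mod_cast hj
  have hc : 2 * π / T * j ≠ 0 := by positivity
  rw [intervalIntegral.integral_comp_mul_sub (fun x => cos x) hc, integral_cos]
  have h : 2 * π / T * j * T - θ = -θ + j * (2 * π) := by field_simp; ring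
  rw [h, sin_add_int_mul_two_pi]
  simp

/-- Product-to-sum formula for the bilinear form `L⟨v, w⟩ - ⟨deriv v, deriv w⟩` on two harmonics. -/
lemma integral_harmonic_pair {T : ℝ} (L : ℝ) (m n : ℕ) (α β : ℝ) :
    ∫ s in (0:ℝ)..T, (L * (cos (2 * π / T * m * s - α) * cos (2 * π / T * n * s - β)) -
        (2 * π / T) ^ 2 * (m * n) * (sin (2 * π / T * m * s - α) * sin (2 * π / T * n * s - β))) =
      (L - (2 * π / T) ^ 2 * (m * n)) / 2 *
          (∫ s in (0:ℝ)..T, cos (2 * π / T * ((m - n : ℤ) : ℝ) * s - (α - β))) +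
        (L + (2 * π / T) ^ 2 * (m * n)) / 2 *
          (∫ s in (0:ℝ)..T, cos (2 * π / T * ((m + n : ℤ) : ℝ) * s - (α + β))) := by
  rw [← intervalIntegral.integral_const_mul, ← intervalIntegral.integral_const_mul,
    ← intervalIntegral.integral_add
      (Continuous.intervalIntegrable (by fun_prop) _ _)
      (Continuous.intervalIntegrable (by fun_prop) _ _)]
  congr 1
  funext s
  have h₁ : 2 * π / T * ((m - n : ℤ) : ℝ) * s - (α - β) =
      (2 * π / T * m * s - α) - (2 * π / T * n * s - β) := by push_cast; ring
  have h₂ : 2 * π / T * ((m + n : ℤ) : ℝ) * s - (α + β) =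
      (2 * π / T * m * s - α) + (2 * π / T * n * s - β) := by push_cast; ring
  rw [h₁, h₂, cos_sub (2 * π / T * m * s - α), cos_add]
  ring

lemma integral_harmonic_pair_of_ne {T : ℝ} (hT : T ≠ 0) (L : ℝ) {m n : ℕ} (hmn : m ≠ n)
    (α β : ℝ) :
    ∫ s in (0:ℝ)..T, (L * (cos (2 * π / T * m * s - α) * cos (2 * π / T * n * s - β)) -
        (2 * π / T) ^ 2 * (m * n) *
          (sin (2 * π / T * m * s - α) * sin (2 * π / T * n * s - β))) = 0 := by
  rw [integral_harmonic_pair, integral_cos_mul_sub_eq_zero hT (by omega),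
    integral_cos_mul_sub_eq_zero hT (by omega)]
  ring

lemma integral_harmonic_self_nonneg {T : ℝ} (hT : 0 < T) {k m : ℕ} (hm : m ≤ k) (α : ℝ) :
    0 ≤ ∫ s in (0:ℝ)..T, ((2 * π / T * k) ^ 2 *
        (cos (2 * π / T * m * s - α) * cos (2 * π / T * m * s - α)) -
        (2 * π / T) ^ 2 * (m * m) *
          (sin (2 * π / T * m * s - α) * sin (2 * π / T * m * s - α))) := by
  rcases Nat.eq_zero_or_pos m with rfl | h0
  · refine intervalIntegral.integral_nonneg hT.le fun s _ => ?_
    simp only [Nat.cast_zero, zero_mul, mul_zero, sub_zero]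
    exact mul_nonneg (sq_nonneg _) (mul_self_nonneg _)
  · rw [integral_harmonic_pair, integral_cos_mul_sub_eq_zero hT.ne' (j := (m : ℤ) + m) (by omega)]
    have hmk : (m : ℝ) * m ≤ (k : ℝ) ^ 2 := by
      rw [← sq]; gcongr
    have h := mul_le_mul_of_nonneg_left hmk (sq_nonneg (2 * π / T))
    simp only [sub_self, Int.cast_zero, mul_zero, zero_mul, cos_zero, add_zero,
      intervalIntegral.integral_const, sub_zero, smul_eq_mul, mul_one]
    have : 0 ≤ (2 * π / T * k) ^ 2 - (2 * π / T) ^ 2 * (m * m) := by rw [mul_pow]; linarith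
    positivity

/-- Bernstein's inequality in `L²` for trigonometric polynomials. -/
lemma integral_deriv_trigPoly_sq_le {T : ℝ} (hT : 0 < T) (k : ℕ) (r φ : ℕ → ℝ) :
    0 ≤ ∫ s in (0:ℝ)..T, ((2 * π / T * k) ^ 2 * trigPoly (2 * π / T) k r φ s ^ 2 -
      deriv (trigPoly (2 * π / T) k r φ) s ^ 2) := by
  have h : ∀ s, (2 * π / T * k) ^ 2 * trigPoly (2 * π / T) k r φ s ^ 2 -
      deriv (trigPoly (2 * π / T) k r φ) s ^ 2 =
      ∑ m ∈ Finset.range (k + 1), ∑ n ∈ Finset.range (k + 1), r m * r n *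
        ((2 * π / T * k) ^ 2 * (cos (2 * π / T * m * s - φ m) * cos (2 * π / T * n * s - φ n)) -
        (2 * π / T) ^ 2 * (m * n) *
          (sin (2 * π / T * m * s - φ m) * sin (2 * π / T * n * s - φ n))) := by
    intro s
    rw [(hasDerivAt_trigPoly _ _ _ _ _).deriv, trigPoly, sq (Finset.sum _ _), sq (Finset.sum _ _),
      Finset.sum_mul_sum, Finset.sum_mul_sum, Finset.mul_sum, ← Finset.sum_sub_distrib]
    refine Finset.sum_congr rfl fun m _ => ?_
    rw [Finset.mul_sum, ← Finset.sum_sub_distrib]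
    exact Finset.sum_congr rfl fun n _ => by ring
  simp_rw [h]
  rw [intervalIntegral.integral_finsetSum
    fun m _ => Continuous.intervalIntegrable (by fun_prop) _ _]
  refine Finset.sum_nonneg fun m hm => ?_
  rw [intervalIntegral.integral_finsetSum
    fun n _ => Continuous.intervalIntegrable (by fun_prop) _ _]
  refine Finset.sum_nonneg fun n _ => ?_
  rw [intervalIntegral.integral_const_mul]
  rcases eq_or_ne m n with rfl | hne
  · exact mul_nonneg (mul_self_nonneg _)
      (integral_harmonic_self_nonneg hT (Nat.lt_succ_iff.mp (Finset.mem_range.mp hm)) _)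
  · rw [integral_harmonic_pair_of_ne hT.ne' _ hne, mul_zero]

lemma exists_eq_trigPoly_of_mem_span {T : ℝ} {k : ℕ} {v : ℝ → ℝ}
    (hv : v ∈ Submodule.span ℝ
          {g : ℝ → ℝ | ∃ m : ℕ, m ≤ k ∧
            ((g = fun s => Real.cos (2 * π * m * s / T)) ∨
             (g = fun s => Real.sin (2 * π * m * s / T)))}) :
    ∃ r φ : ℕ → ℝ, v = trigPoly (2 * π / T) k r φ := by
  have key : ∃ a b : ℕ → ℝ, v = fun s => ∑ m ∈ Finset.range (k + 1),
      (a m * cos (2 * π / T * m * s) + b m * sin (2 * π / T * m * s)) := by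
    induction hv using Submodule.span_induction with
    | mem g hg =>
      obtain ⟨m, hm, rfl | rfl⟩ := hg
      · refine ⟨Pi.single m 1, 0, funext fun s => ?_⟩
        rw [Finset.sum_eq_single_of_mem m (by simpa [Nat.lt_succ_iff] using hm)
          (fun n _ hn => by simp [hn])]
        simp only [Pi.single_eq_same, Pi.zero_apply, zero_mul, add_zero, one_mul]
        congr 1; ring
      · refine ⟨0, Pi.single m 1, funext fun s => ?_⟩
        rw [Finset.sum_eq_single_of_mem m (by simpa [Nat.lt_succ_iff] using hm)
          (fun n _ hn => by simp [hn])]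
        simp only [Pi.single_eq_same, Pi.zero_apply, zero_mul, zero_add, one_mul]
        congr 1; ring
    | zero => exact ⟨0, 0, by ext; simp⟩
    | add x y _ _ hx hy =>
      obtain ⟨a, b, rfl⟩ := hx
      obtain ⟨a', b', rfl⟩ := hy
      refine ⟨a + a', b + b', funext fun s => ?_⟩
      simp only [Pi.add_apply, ← Finset.sum_add_distrib]
      exact Finset.sum_congr rfl fun m _ => by ring
    | smul t x _ hx =>
      obtain ⟨a, b, rfl⟩ := hx
      refine ⟨t • a, t • b, funext fun s => ?_⟩
      simp only [Pi.smul_apply, smul_eq_mul, Finset.mul_sum]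
      exact Finset.sum_congr rfl fun m _ => by ring
  obtain ⟨a, b, rfl⟩ := key
  refine ⟨fun m => ‖(⟨a m, b m⟩ : ℂ)‖, fun m => Complex.arg ⟨a m, b m⟩, funext fun s => ?_⟩
  refine Finset.sum_congr rfl fun m _ => ?_
  have h₁ := Complex.norm_mul_cos_arg ⟨a m, b m⟩
  have h₂ := Complex.norm_mul_sin_arg ⟨a m, b m⟩
  simp only at h₁ h₂
  rw [cos_sub]
  linear_combination -cos (2 * π / T * m * s) * h₁ - sin (2 * π / T * m * s) * h₂

/-- definite negativity of B₀ on the span of the low Fourier modes, for ρ in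
the middle of the interval I_k. -/
theorem tube_zero_mode_low_modes_negative :
    ∃ c > (0:ℝ), ∀ μ T : ℝ, 0 < μ → 0 < T → ∀ k : ℕ,
      2 * π * (k + 1/3) ≤ Real.sqrt μ * T → Real.sqrt μ * T ≤ 2 * π * (k + 2/3) →
      ∀ v : ℝ → ℝ, v ∈ Submodule.span ℝ
          {g : ℝ → ℝ | ∃ m : ℕ, m ≤ k ∧
            ((g = fun s => Real.cos (2 * π * m * s / T)) ∨
             (g = fun s => Real.sin (2 * π * m * s / T)))} →
      (∫ s in (0:ℝ)..T, (μ * (v s) ^ 2 - (deriv v s) ^ 2)) ≥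
        c * (1 + Real.sqrt μ * T)⁻¹ *
          ∫ s in (0:ℝ)..T, ((deriv v s) ^ 2 + μ * (v s) ^ 2) := by
  refine ⟨1, one_pos, fun μ T hμ hT k hlow _ v hv => ?_⟩
  obtain ⟨r, φ, rfl⟩ := exists_eq_trigPoly_of_mem_span hv
  have hB := integral_deriv_trigPoly_sq_le hT k r φ
  set v := trigPoly (2 * π / T) k r φ with hvdef
  have hcv : Continuous v := by rw [hvdef]; unfold trigPoly; fun_prop
  have hcd : Continuous (deriv v) := by
    have hd : deriv v = _ := funext fun s => (hasDerivAt_trigPoly (2 * π / T) k r φ s).deriv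
    rw [hd]
    fun_prop
  have hi : IntervalIntegrable (fun s => v s ^ 2) MeasureTheory.volume 0 T :=
    (hcv.pow 2).intervalIntegrable _ _
  have hi' : IntervalIntegrable (fun s => deriv v s ^ 2) MeasureTheory.volume 0 T :=
    (hcd.pow 2).intervalIntegrable _ _
  rw [intervalIntegral.integral_sub (hi.const_mul _) hi',
    intervalIntegral.integral_const_mul] at hB ⊢
  rw [intervalIntegral.integral_add hi' (hi.const_mul _), intervalIntegral.integral_const_mul]
  have hV : 0 ≤ ∫ s in (0:ℝ)..T, v s ^ 2 :=
    intervalIntegral.integral_nonneg hT.le fun s _ => sq_nonneg _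
  generalize (∫ s in (0:ℝ)..T, v s ^ 2) = V at hB hV ⊢
  generalize (∫ s in (0:ℝ)..T, deriv v s ^ 2) = D at hB ⊢
  set x := √μ * T with hx
  have hx0 : 0 < x := by positivity
  set y := 2 * π * k with hy
  have hy0 : 0 ≤ y := by positivity
  have hxy : 2 ≤ x - y := by
    have := pi_gt_three
    linarith
  have hμx : μ = x ^ 2 / T ^ 2 := by
    rw [hx, mul_pow, sq_sqrt hμ.le]; field_simp
  have hyT : (2 * π / T * k) ^ 2 = y ^ 2 / T ^ 2 := by rw [hy]; field_simp
  rw [hyT] at hB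
  rw [ge_iff_le, one_mul, inv_mul_le_iff₀ (by positivity)]
  have hfreq : (2 + x) * y ^ 2 ≤ x * x ^ 2 := by
    nlinarith [mul_nonneg hx0.le hy0, mul_nonneg hx0.le (by linarith : 0 ≤ x - y - 2),
      mul_nonneg (mul_nonneg hx0.le hy0) (by linarith : 0 ≤ x - y - 2),
      mul_nonneg (mul_nonneg hx0.le hx0.le) (by linarith : 0 ≤ x - y - 2),
      mul_nonneg hy0 (by linarith : 0 ≤ x - y - 2)]
  have hW : (2 + x) * (y ^ 2 / T ^ 2 * V) ≤ x * (μ * V) := by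
    rw [hμx]
    have := mul_le_mul_of_nonneg_right hfreq (by positivity : 0 ≤ V / T ^ 2)
    calc _ = (2 + x) * y ^ 2 * (V / T ^ 2) := by ring
      _ ≤ _ := this
      _ = _ := by ring
  have hD := mul_le_mul_of_nonneg_left (sub_nonneg.mp hB) (by linarith : 0 ≤ 2 + x)
  linarith
end

section
/- There is a universal constant c > 0 with the following property. Let μ > 0, T > 0 and let k be a nonnegative integer with 2π(k + 1/3) ≤ √μ·T ≤ 2π(k + 2/3). Then every T-periodic C¹ function v : ℝ → ℝ satisfying ∫₀ᵀ v(s)·cos(2πms/T) ds = 0 and ∫₀ᵀ v(s)·sin(2πms/T) ds = 0 for all integers 0 ≤ m ≤ k satisfies ∫₀ᵀ ( v'(s)² − μ·v(s)² ) ds ≥ c·(1 + √μ·T)⁻¹ · ∫₀ᵀ ( v'(s)² + μ·v(s)² ) ds. -/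
open Real

theorem fourierCoeffOn_ofReal_eq {T : ℝ} (hT : 0 < T) {v : ℝ → ℝ} (hv : Continuous v) (n : ℤ) :
    fourierCoeffOn hT (fun s => (v s : ℂ)) n =
      (1 / T : ℝ) • (((∫ s in (0:ℝ)..T, v s * Real.cos (2 * π * n * s / T) : ℝ) : ℂ) -
        ((∫ s in (0:ℝ)..T, v s * Real.sin (2 * π * n * s / T) : ℝ) : ℂ) * Complex.I) := by
  rw [fourierCoeffOn_eq_integral, ← intervalIntegral.integral_ofReal,
    ← intervalIntegral.integral_ofReal, ← intervalIntegral.integral_mul_const,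
    ← intervalIntegral.integral_sub]
  · rw [sub_zero]
    congr 1
    refine intervalIntegral.integral_congr fun s _ => ?_
    have h : 2 * (π : ℂ) * Complex.I * ((-n : ℤ) : ℂ) * (s : ℂ) / (T : ℂ)
        = ((-(2 * π * n * s / T) : ℝ) : ℂ) * Complex.I := by
      push_cast
      ring
    simp only [fourier_coe_apply]
    rw [h, Complex.exp_mul_I, ← Complex.ofReal_cos, ← Complex.ofReal_sin, Real.cos_neg,
      Real.sin_neg, smul_eq_mul]
    push_cast
    ring
  all_goals exact Continuous.intervalIntegrable (by fun_prop) _ _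

theorem fourierCoeffOn_ofReal_eq_zero {T : ℝ} (hT : 0 < T) {v : ℝ → ℝ} (hv : Continuous v)
    {n : ℤ} (hcos : ∫ s in (0:ℝ)..T, v s * Real.cos (2 * π * n.natAbs * s / T) = 0)
    (hsin : ∫ s in (0:ℝ)..T, v s * Real.sin (2 * π * n.natAbs * s / T) = 0) :
    fourierCoeffOn hT (fun s => (v s : ℂ)) n = 0 := by
  rw [fourierCoeffOn_ofReal_eq hT hv]
  obtain ⟨m, rfl | rfl⟩ := n.eq_nat_or_neg
  · simp only [Int.natAbs_natCast] at hcos hsin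
    simp [hcos, hsin]
  · simp only [Int.natAbs_neg, Int.natAbs_natCast] at hcos hsin
    simp [neg_div, hcos, hsin]

theorem norm_sq_fourierCoeffOn_deriv {T : ℝ} (hT : 0 < T) {v : ℝ → ℝ} (hv : ContDiff ℝ 1 v)
    (hper : Function.Periodic v T) {n : ℤ} (hn : n ≠ 0) :
    ‖fourierCoeffOn hT (fun s => ((deriv v s : ℝ) : ℂ)) n‖ ^ 2 =
      (2 * π * n / T) ^ 2 * ‖fourierCoeffOn hT (fun s => (v s : ℂ)) n‖ ^ 2 := by
  have hd : Continuous (deriv v) := hv.continuous_deriv le_rfl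
  have h0 : v T = v 0 := by simpa using hper 0
  have h := fourierCoeffOn_of_hasDerivAt hT (f := fun s => (v s : ℂ))
    (f' := fun s => ((deriv v s : ℝ) : ℂ)) hn
    (fun x _ => ((hv.differentiable one_ne_zero) x).hasDerivAt.ofReal_comp)
    (Continuous.intervalIntegrable (by fun_prop) _ _)
  have hn' : (n : ℝ) ≠ 0 := by exact_mod_cast hn
  rw [h, h0, sub_self, mul_zero, zero_sub, norm_mul, norm_neg, norm_mul]
  simp only [Complex.ofReal_zero, sub_zero, norm_div, norm_mul, norm_neg, norm_one,
    Complex.norm_real, Complex.norm_I, Complex.norm_intCast, Real.norm_eq_abs, Complex.norm_ofNat,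
    mul_one, mul_pow, div_pow, one_pow, sq_abs]
  field_simp

open MeasureTheory in
theorem hasSum_sq_fourierCoeffOn_ofReal {T : ℝ} (hT : 0 < T) {v : ℝ → ℝ} (hv : Continuous v) :
    HasSum (fun n => ‖fourierCoeffOn hT (fun s => (v s : ℂ)) n‖ ^ 2)
      (T⁻¹ * ∫ s in (0:ℝ)..T, v s ^ 2) := by
  have hc : Continuous fun s => (v s : ℂ) := by fun_prop
  have hL2 : MemLp (fun s => (v s : ℂ)) 2 (volume.restrict (Set.Ioc 0 T)) := by
    rw [memLp_two_iff_integrable_sq_norm hc.aestronglyMeasurable]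
    exact (Continuous.integrableOn_Icc (by fun_prop)).mono_set Set.Ioc_subset_Icc_self
  simpa using hasSum_sq_fourierCoeffOn hT hL2

/-- Wirtinger's inequality for periodic functions without Fourier modes of order at most `k`. -/
theorem wirtinger_of_low_modes_eq_zero {T : ℝ} (hT : 0 < T) {v : ℝ → ℝ} (hv : ContDiff ℝ 1 v)
    (hper : Function.Periodic v T) (k : ℕ)
    (hlow : ∀ m : ℕ, m ≤ k →
      (∫ s in (0:ℝ)..T, v s * Real.cos (2 * π * m * s / T)) = 0 ∧
      (∫ s in (0:ℝ)..T, v s * Real.sin (2 * π * m * s / T)) = 0) :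
    (2 * π * (k + 1) / T) ^ 2 * ∫ s in (0:ℝ)..T, v s ^ 2 ≤ ∫ s in (0:ℝ)..T, deriv v s ^ 2 := by
  have hle := hasSum_le (fun n => ?_)
    ((hasSum_sq_fourierCoeffOn_ofReal hT hv.continuous).mul_left ((2 * π * (k + 1) / T) ^ 2))
    (hasSum_sq_fourierCoeffOn_ofReal hT (hv.continuous_deriv le_rfl))
  · rw [mul_left_comm] at hle
    exact le_of_mul_le_mul_left hle (inv_pos.2 hT)
  · rcases le_or_gt n.natAbs k with hnk | hnk
    · rw [fourierCoeffOn_ofReal_eq_zero hT hv.continuous (hlow _ hnk).1 (hlow _ hnk).2]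
      simp
    · rw [norm_sq_fourierCoeffOn_deriv hT hv hper (by omega)]
      have hkn : (k + 1 : ℝ) ≤ |(n : ℝ)| := by
        rw [← Int.cast_abs, Int.abs_eq_natAbs]
        exact_mod_cast hnk
      refine mul_le_mul_of_nonneg_right (sq_le_sq.2 ?_) (sq_nonneg _)
      have hπ := Real.pi_pos
      rw [abs_div, abs_div, abs_mul, abs_mul _ (n : ℝ), abs_of_nonneg (by positivity : (0:ℝ) ≤ k + 1)]
      gcongr

/-- coercivity of B₀ on the orthogonal complement of the low Fourier modes,
for ρ in the middle of the interval I_k. -/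
theorem tube_zero_mode_high_modes_coercive :
    ∃ c > (0:ℝ), ∀ μ T : ℝ, 0 < μ → 0 < T → ∀ k : ℕ,
      2 * π * (k + 1/3) ≤ Real.sqrt μ * T → Real.sqrt μ * T ≤ 2 * π * (k + 2/3) →
      ∀ v : ℝ → ℝ, ContDiff ℝ 1 v → Function.Periodic v T →
      (∀ m : ℕ, m ≤ k →
        (∫ s in (0:ℝ)..T, v s * Real.cos (2 * π * m * s / T)) = 0 ∧
        (∫ s in (0:ℝ)..T, v s * Real.sin (2 * π * m * s / T)) = 0) →
      (∫ s in (0:ℝ)..T, ((deriv v s) ^ 2 - μ * (v s) ^ 2)) ≥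
        c * (1 + Real.sqrt μ * T)⁻¹ *
          ∫ s in (0:ℝ)..T, ((deriv v s) ^ 2 + μ * (v s) ^ 2) := by
  refine ⟨1 / 4, by norm_num, fun μ T hμ hT k hk1 hk2 v hv hper hlow => ?_⟩
  have hd : Continuous (deriv v) := hv.continuous_deriv le_rfl
  have hc : Continuous v := hv.continuous
  have hW := wirtinger_of_low_modes_eq_zero hT hv hper k hlow
  have hX : 0 ≤ ∫ s in (0:ℝ)..T, v s ^ 2 :=
    intervalIntegral.integral_nonneg hT.le fun s _ => sq_nonneg _
  have hi1 : IntervalIntegrable (fun s => deriv v s ^ 2) MeasureTheory.volume 0 T :=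
    Continuous.intervalIntegrable (by fun_prop) _ _
  have hi2 : IntervalIntegrable (fun s => μ * v s ^ 2) MeasureTheory.volume 0 T :=
    Continuous.intervalIntegrable (by fun_prop) _ _
  rw [intervalIntegral.integral_sub hi1 hi2, intervalIntegral.integral_add hi1 hi2,
    intervalIntegral.integral_const_mul]
  set X := ∫ s in (0:ℝ)..T, v s ^ 2
  set Y := ∫ s in (0:ℝ)..T, deriv v s ^ 2
  set t := Real.sqrt μ * T with ht
  set P := 2 * π * (k + 1 : ℝ) with hP
  have ht0 : 0 ≤ t := by positivity
  have hμt : μ = (t / T) ^ 2 := by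
    rw [ht, mul_div_cancel_right₀ _ hT.ne', Real.sq_sqrt hμ.le]
  have hPt : 2 ≤ P - t := by linarith [Real.pi_gt_three]
  have hPt' : P ≤ t + 21 / 5 := by linarith [Real.pi_lt_d2]
  obtain ⟨δ, hδ⟩ : ∃ δ, δ = 1 / 4 * (1 + t)⁻¹ := ⟨_, rfl⟩
  have hδt : δ * (1 + t) = 1 / 4 := by
    rw [hδ]
    field_simp
  have hδ0 : 0 < δ := by rw [hδ]; positivity
  have hδ1 : δ ≤ 1 / 4 := by nlinarith
  have hgap : (1 + δ) * t ^ 2 ≤ (1 - δ) * P ^ 2 := by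
    have h1 : δ * (P + t) ≤ P - t := by nlinarith
    have h2 : δ * (P + t) * (P + t) ≤ (P - t) * (P + t) :=
      mul_le_mul_of_nonneg_right h1 (by linarith)
    have h3 : 0 ≤ δ * (2 * P * t) := by
      have : 0 ≤ P := by linarith
      positivity
    nlinarith
  have hY : (1 - δ) * ((P / T) ^ 2 * X) ≤ (1 - δ) * Y :=
    mul_le_mul_of_nonneg_left hW (by linarith)
  have hgapX := mul_le_mul_of_nonneg_right hgap (div_nonneg hX (sq_nonneg T))
  have e1 : (1 + δ) * t ^ 2 * (X / T ^ 2) = (1 + δ) * (μ * X) := by rw [hμt]; ring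
  have e2 : (1 - δ) * P ^ 2 * (X / T ^ 2) = (1 - δ) * ((P / T) ^ 2 * X) := by ring
  rw [e1, e2] at hgapX
  rw [← hδ]
  linarith
end

section
/- Let n ≥ 2 be an integer, ρ > 0 a real number, and let k and j be nonnegative integers. Then −k² + ρ^{-2}·( n − 1 − j(n + j − 2) ) = 0 if and only if either (j = 1 and k = 0) or (j = 0 and k²·ρ² = n − 1). -/
open Real

/-- the Jacobi eigenvalue B(k,j,ρ) = −k² + ρ⁻²(n−1−j(n+j−2)) on the flat torus
vanishes iff (j=1 and k=0) or (j=0 and k²ρ² = n−1). -/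
theorem flat_torus_jacobi_degeneracy (n : ℕ) (hn : 2 ≤ n) (ρ : ℝ) (hρ : 0 < ρ)
    (k j : ℕ) :
    (-(k:ℝ) ^ 2 + (ρ ^ 2)⁻¹ * ((n:ℝ) - 1 - (j:ℝ) * ((n:ℝ) + (j:ℝ) - 2)) = 0) ↔
    ((j = 1 ∧ k = 0) ∨ (j = 0 ∧ (k:ℝ) ^ 2 * ρ ^ 2 = (n:ℝ) - 1)) := by
  have hρ2 : 0 < ρ ^ 2 := by positivity
  have hn' : (2 : ℝ) ≤ n := by exact_mod_cast hn
  have key : (-(k:ℝ) ^ 2 + (ρ ^ 2)⁻¹ * ((n:ℝ) - 1 - (j:ℝ) * ((n:ℝ) + (j:ℝ) - 2)) = 0) ↔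
      (k:ℝ) ^ 2 * ρ ^ 2 = (1 - (j:ℝ)) * ((n:ℝ) - 1 + j) := by
    rw [neg_add_eq_zero, eq_inv_mul_iff_mul_eq₀ hρ2.ne', mul_comm]
    ring_nf
  rw [key]
  rcases j with _ | _ | j
  · simp
  · simp [hρ.ne']
  · have hneg : (1 - ((j + 1 + 1 : ℕ) : ℝ)) * ((n:ℝ) - 1 + ((j + 1 + 1 : ℕ) : ℝ)) < 0 := by
      have hj : (0 : ℝ) ≤ j := j.cast_nonneg
      push_cast
      exact mul_neg_of_neg_of_pos (by linarith) (by linarith)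
    have hnonneg : 0 ≤ (k:ℝ) ^ 2 * ρ ^ 2 := by positivity
    constructor
    · intro h
      linarith
    · rintro (⟨h, -⟩ | ⟨h, -⟩) <;> omega
end
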